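/- Let n ≥ 3, 0 < α < 1 and ζ > 2. Let a_{ij} : ℝⁿ → ℝ (1 ≤ i,j ≤ n) be symmetric coefficients such that: (i) there are 0 < λ ≤ Λ with λ|ξ|² ≤ Σ_{i,j} a_{ij}(x) ξᵢξⱼ ≤ Λ|ξ|² for all x, ξ ∈ ℝⁿ; (ii) each a_{ij} has finite global α-Hölder seminorm [a_{ij}]_{C^α(ℝⁿ)} < ∞; (iii) there exist a symmetric positive definite matrix (a_{ij}(∞)) and constants ε₀, C₀ > 0 with |a_{ij}(x) − a_{ij}(∞)| ≤ C₀|x|^{−ε₀} for all x ≠ 0. Let f : ℝⁿ → ℝ be continuous with limsup_{|x|→∞} |x|^ζ |f(x)| < ∞, and let v ∈ C²(ℝⁿ) satisfy Σ_{i,j} a_{ij}(x) ∂ᵢ∂ⱼ v(x) = f(x) for all x ∈ ℝⁿ, with |Dv(x)| = O(|x|^{−1}) as |x| → ∞. Then v is bounded from at least one side on ℝⁿ, i.e. v is bounded above or bounded below. -/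

import Mathlib

open Filter

/-- The Hessian matrix `(∂ᵢ∂ⱼ v(x))` of a function on Euclidean space. -/
noncomputable def hess {n : ℕ} (v : EuclideanSpace ℝ (Fin n) → ℝ)
    (x : EuclideanSpace ℝ (Fin n)) : Matrix (Fin n) (Fin n) ℝ :=
  Matrix.of fun i j =>
    iteratedFDeriv ℝ 2 v x ![EuclideanSpace.single i 1, EuclideanSpace.single j 1]
open Topology

def D2 (φ : ℝ → ℝ) (d : ℝ) : Prop :=
  ∃ φ' : ℝ → ℝ, (∀ᶠ t in 𝓝 (0:ℝ), HasDerivAt φ (φ' t) t) ∧ HasDerivAt φ' d 0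

lemma D2.add {φ ψ : ℝ → ℝ} {d e : ℝ} (h : D2 φ d) (k : D2 ψ e) :
    D2 (fun t => φ t + ψ t) (d + e) := by
  obtain ⟨φ', h1, h2⟩ := h
  obtain ⟨ψ', k1, k2⟩ := k
  refine ⟨fun t => φ' t + ψ' t, ?_, h2.add k2⟩
  filter_upwards [h1, k1] with t a b using a.add b

lemma D2.const_mul {φ : ℝ → ℝ} {d : ℝ} (K : ℝ) (h : D2 φ d) :
    D2 (fun t => K * φ t) (K * d) := by
  obtain ⟨φ', h1, h2⟩ := h
  refine ⟨fun t => K * φ' t, ?_, h2.const_mul K⟩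
  filter_upwards [h1] with t a using a.const_mul K

lemma D2.nonneg {φ : ℝ → ℝ} {d : ℝ} (h : D2 φ d) (hm : IsLocalMin φ 0) : 0 ≤ d := by
  obtain ⟨φ', h1, h2⟩ := h
  by_contra! hd
  have e : deriv φ =ᶠ[𝓝 0] φ' := by
    filter_upwards [h1] with t ht using ht.deriv
  have hdd : deriv (deriv φ) 0 = d := by rw [e.deriv_eq]; exact h2.deriv
  have hM := isLocalMax_of_deriv_deriv_neg (f := φ) (x₀ := 0) (by rw [hdd]; exact hd)
    hm.deriv_eq_zero h1.self_of_nhds.continuousAt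
  have hc : φ =ᶠ[𝓝 0] fun _ => φ 0 := by
    filter_upwards [hm, hM] with t a b using le_antisymm b a
  have : deriv (deriv φ) 0 = 0 := by
    rw [hc.deriv.deriv_eq]; simp
  linarith

lemma D2_pow (Q b q p : ℝ) (hQ : 0 < Q) :
    D2 (fun t => (Q + 2 * t * b + t ^ 2 * q) ^ p)
      (2 * p * q * Q ^ (p - 1) + 4 * p * (p - 1) * b ^ 2 * Q ^ (p - 2)) := by
  have hg : ∀ t, HasDerivAt (fun t : ℝ => Q + 2 * t * b + t ^ 2 * q) (2 * b + 2 * t * q) t := by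
    intro t
    have := (((hasDerivAt_id t).const_mul 2).mul_const b).const_add Q |>.add
      (((hasDerivAt_id t).pow 2).mul_const q)
    exact this.congr_deriv (by simp)
  have hpos : ∀ᶠ t in 𝓝 (0:ℝ), 0 < Q + 2 * t * b + t ^ 2 * q := by
    have hc : ContinuousAt (fun t : ℝ => Q + 2 * t * b + t ^ 2 * q) 0 := (hg 0).continuousAt
    exact hc.eventually (lt_mem_nhds (by simpa using hQ))
  refine ⟨fun t => (2 * b + 2 * t * q) * p * (Q + 2 * t * b + t ^ 2 * q) ^ (p - 1), ?_, ?_⟩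
  · filter_upwards [hpos] with t ht
    exact (hg t).rpow_const (Or.inl ht.ne')
  · have h1 : HasDerivAt (fun t : ℝ => (2 * b + 2 * t * q) * p) (2 * q * p) 0 := by
      have := ((((hasDerivAt_id (0:ℝ)).const_mul 2).mul_const q).const_add (2 * b)).mul_const p
      exact this.congr_deriv (by simp)
    have h2 := (hg 0).rpow_const (p := p - 1) (Or.inl (by simpa using hQ.ne'))
    refine (h1.mul h2).congr_deriv ?_
    simp only [mul_zero, zero_mul, add_zero, ne_eq, OfNat.ofNat_ne_zero, not_false_eq_true, zero_pow]
    rw [show p - 1 - 1 = p - 2 by ring]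
    ring

lemma D2_line {n : ℕ} (v : EuclideanSpace ℝ (Fin n) → ℝ) (hv : ContDiff ℝ 2 v)
    (x c : EuclideanSpace ℝ (Fin n)) :
    D2 (fun t : ℝ => v (x + t • c)) (∑ i, ∑ j, c i * c j * hess v x i j) := by
  have hl : ∀ t : ℝ, HasDerivAt (fun t : ℝ => x + t • c) c t := by
    intro t
    simpa using ((hasDerivAt_id t).smul_const c).const_add x
  have hd : Differentiable ℝ v := hv.differentiable (by norm_num)
  have hd2 : Differentiable ℝ (fderiv ℝ v) :=
    (hv.fderiv_right (m := 1) (by norm_num)).differentiable (by norm_num)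
  refine ⟨fun t => fderiv ℝ v (x + t • c) c, ?_, ?_⟩
  · filter_upwards with t
    exact (hd (x + t • c)).hasFDerivAt.comp_hasDerivAt t (hl t)
  · have h := (hd2 (x + (0:ℝ) • c)).hasFDerivAt.comp_hasDerivAt (0:ℝ) (hl 0)
    have h' := h.clm_apply (hasDerivAt_const (0:ℝ) c)
    refine h'.congr_deriv ?_
    symm
    simp only [zero_smul, add_zero, map_zero]
    have hc : c = ∑ i, c i • EuclideanSpace.single i (1:ℝ) := by
      ext j
      simp [Finset.sum_apply, Pi.single_apply]
    conv_rhs => rw [hc]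
    simp only [map_sum, map_smul, _root_.sum_apply, _root_.smul_apply,
      hess, Matrix.of_apply, iteratedFDeriv_two_apply, smul_eq_mul, Finset.mul_sum]
    rw [Finset.sum_comm]
    simp [mul_assoc, mul_comm, mul_left_comm]

lemma osc {n : ℕ} (hn : 3 ≤ n) (v : EuclideanSpace ℝ (Fin n) → ℝ) (hv : ContDiff ℝ 2 v)
    (C R : ℝ) (hC : 0 < C) (hR : 0 < R)
    (h : ∀ x : EuclideanSpace ℝ (Fin n), R ≤ ‖x‖ → ‖fderiv ℝ v x‖ ≤ C * ‖x‖⁻¹)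
    (x y : EuclideanSpace ℝ (Fin n)) (hx : 2 * R ≤ ‖x‖) (hxy : ‖x‖ = ‖y‖) :
    v x - v y ≤ 8 * C := by
  have key : ∀ x y : EuclideanSpace ℝ (Fin n), 2 * R ≤ ‖x‖ → ‖x‖ = ‖y‖ → inner ℝ x y = 0 →
      v x - v y ≤ 4 * C := by
    intro x y hx hxy hin
    have hr : 0 < ‖x‖ := by linarith
    have hseg : ∀ z ∈ segment ℝ y x, ‖x‖ / 2 ≤ ‖z‖ := by
      rintro z ⟨s, t, hs, ht, hst, rfl⟩
      have : ‖s • y + t • x‖ ^ 2 = (s ^ 2 + t ^ 2) * ‖x‖ ^ 2 := by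
        rw [norm_add_sq_real, inner_smul_left, inner_smul_right, real_inner_comm, hin, norm_smul,
          norm_smul, ← hxy]
        simp [mul_pow]; ring
      refine abs_le_of_sq_le_sq' ?_ (norm_nonneg _) |>.2
      rw [this]
      have : 1/4 ≤ s ^ 2 + t ^ 2 := by nlinarith [sq_nonneg (s - t)]
      nlinarith [sq_nonneg ‖x‖]
    have := (convex_segment y x).norm_image_sub_le_of_norm_fderiv_le (𝕜 := ℝ) (f := v)
      (C := C * (‖x‖/2)⁻¹)
      (fun z _ => hv.differentiable (by norm_num) z) (fun z hz => ?_)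
      (left_mem_segment ℝ y x) (right_mem_segment ℝ y x)
    · have h2 : ‖x - y‖ ≤ 2 * ‖x‖ := by
        have := norm_sub_le x y; linarith
      have h3 : C * (‖x‖/2)⁻¹ * ‖x - y‖ ≤ C * (‖x‖/2)⁻¹ * (2 * ‖x‖) := by gcongr
      have h4 : C * (‖x‖/2)⁻¹ * (2 * ‖x‖) = 4 * C := by field_simp; ring
      have := le_abs_self (v x - v y)
      rw [← Real.norm_eq_abs] at this
      linarith
    · refine (h z (by linarith [hseg z hz])).trans ?_
      gcongr
      exact hseg z hz
  obtain ⟨z, hz0, hz⟩ : ∃ z : EuclideanSpace ℝ (Fin n), z ≠ 0 ∧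
      z ∈ (Submodule.span ℝ {x, y})ᗮ := by
    have h1 := Submodule.finrank_add_finrank_orthogonal (Submodule.span ℝ {x, y})
    have h2 : Module.finrank ℝ (Submodule.span ℝ ({x, y} : Set (EuclideanSpace ℝ (Fin n)))) ≤ 2 := by
      classical
      have := finrank_span_finset_le_card (R := ℝ) ({x, y} : Finset (EuclideanSpace ℝ (Fin n)))
      have h3 := Finset.card_le_two (a := x) (b := y)
      simp only [Finset.coe_insert, Finset.coe_singleton] at this
      exact le_trans this h3
    rw [finrank_euclideanSpace_fin] at h1
    have h3 : (Submodule.span ℝ {x, y})ᗮ ≠ ⊥ := by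
      intro h4
      rw [h4, finrank_bot] at h1
      omega
    obtain ⟨z, hz, hz0⟩ := Submodule.exists_mem_ne_zero_of_ne_bot h3
    exact ⟨z, hz0, hz⟩
  have hxz : inner ℝ x z = 0 := hz x (Submodule.subset_span (by simp))
  have hyz : inner ℝ y z = 0 := hz y (Submodule.subset_span (by simp))
  have hzn : 0 < ‖z‖ := norm_pos_iff.2 hz0
  have hr : 0 < ‖x‖ := by linarith
  have hn' : ‖(‖x‖ / ‖z‖) • z‖ = ‖x‖ := by
    rw [norm_smul, Real.norm_of_nonneg (by positivity)]; field_simp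
  have k1 := key x ((‖x‖ / ‖z‖) • z) hx hn'.symm (by rw [inner_smul_right, hxz, mul_zero])
  have k2 := key ((‖x‖ / ‖z‖) • z) y (by rw [hn']; exact hx) (hn'.trans hxy)
    (by rw [inner_smul_left, real_inner_comm, hyz, mul_zero])
  linarith

lemma final {n : ℕ} (v w : EuclideanSpace ℝ (Fin n) → ℝ) (hv : Continuous v)
    (R K W O : ℝ) (hK : 0 ≤ K)
    (hw : ∀ x, R < ‖x‖ → ContinuousAt w x) (hw0 : ∀ x, R < ‖x‖ → 0 ≤ w x)
    (hwW : ∀ x, R < ‖x‖ → w x ≤ W)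
    (hosc : ∀ x y : EuclideanSpace ℝ (Fin n), R < ‖x‖ → ‖x‖ = ‖y‖ → v x - v y ≤ O)
    (hmin : ∀ x, R < ‖x‖ → ¬ IsLocalMin (fun y => v y + K * w y) x) :
    BddAbove (Set.range v) ∨ BddBelow (Set.range v) := by
  by_contra! hcon
  obtain ⟨hA, hB⟩ := hcon
  have far_up : ∀ r M : ℝ, ∃ x, r < ‖x‖ ∧ M ≤ v x := by
    intro r M
    by_contra! hc
    obtain ⟨m, hm⟩ := (isCompact_closedBall (0 : EuclideanSpace ℝ (Fin n)) r).bddAbove_image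
      hv.continuousOn
    refine hA ⟨max M m, ?_⟩
    rintro _ ⟨x, rfl⟩
    rcases lt_or_ge r ‖x‖ with hx | hx
    · exact (hc x hx).le.trans (le_max_left _ _)
    · exact (hm ⟨x, by simpa using hx, rfl⟩).trans (le_max_right _ _)
  have far_dn : ∀ r M : ℝ, ∃ x, r < ‖x‖ ∧ v x < M := by
    intro r M
    by_contra! hc
    obtain ⟨m, hm⟩ := (isCompact_closedBall (0 : EuclideanSpace ℝ (Fin n)) r).bddBelow_image
      hv.continuousOn
    refine hB ⟨min M m, ?_⟩
    rintro _ ⟨x, rfl⟩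
    rcases lt_or_ge r ‖x‖ with hx | hx
    · exact (min_le_left _ _).trans (hc x hx)
    · exact (min_le_right _ _).trans (hm ⟨x, by simpa using hx, rfl⟩)
  obtain ⟨x1, h1, v1⟩ := far_up R O
  obtain ⟨x2, h2, v2⟩ := far_dn ‖x1‖ (-(K * W))
  obtain ⟨x3, h3, v3⟩ := far_up ‖x2‖ O
  let S : Set (EuclideanSpace ℝ (Fin n)) := {x | ‖x1‖ ≤ ‖x‖ ∧ ‖x‖ ≤ ‖x3‖}
  have hS : IsCompact S := by
    refine (isCompact_closedBall (0 : EuclideanSpace ℝ (Fin n)) ‖x3‖).of_isClosed_subset ?_ ?_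
    · exact (isClosed_le continuous_const continuous_norm).inter
        (isClosed_le continuous_norm continuous_const)
    · intro x hx; simpa using hx.2
  obtain ⟨z, hz, hzm⟩ := hS.exists_isMinOn (f := fun y => v y + K * w y) ⟨x2, h2.le, h3.le⟩
    (fun x hx => (hv.continuousAt.add (continuousAt_const.mul
      (hw x (h1.trans_le hx.1)))).continuousWithinAt)
  have hz2 : v z + K * w z ≤ v x2 + K * w x2 := hzm (show x2 ∈ S from ⟨h2.le, h3.le⟩)
  have hzR : R < ‖z‖ := h1.trans_le hz.1
  have hw2 : K * w x2 ≤ K * W := mul_le_mul_of_nonneg_left (hwW x2 (h1.trans h2)) hK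
  have hwz : 0 ≤ K * w z := mul_nonneg hK (hw0 z hzR)
  have hvz : v z < 0 := by linarith
  have hz1 : ‖x1‖ < ‖z‖ := by
    refine lt_of_le_of_ne hz.1 fun he => ?_
    have := hosc x1 z h1 he
    linarith
  have hz3 : ‖z‖ < ‖x3‖ := by
    refine lt_of_le_of_ne hz.2 fun he => ?_
    have := hosc x3 z (by linarith) he.symm
    linarith
  refine hmin z hzR (hzm.isLocalMin ?_)
  filter_upwards [(continuous_norm.tendsto z).eventually (lt_mem_nhds hz1),
    (continuous_norm.tendsto z).eventually (gt_mem_nhds hz3)] with y a b using ⟨a.le, b.le⟩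

/-- The quadratic form of a matrix. -/
def QF {n : ℕ} (B : Matrix (Fin n) (Fin n) ℝ) (x : EuclideanSpace ℝ (Fin n)) : ℝ :=
  ∑ i, ∑ j, B i j * x i * x j

lemma QF_cont {n : ℕ} (B : Matrix (Fin n) (Fin n) ℝ) : Continuous (QF B) := by
  unfold QF
  fun_prop

lemma QF_line {n : ℕ} (B : Matrix (Fin n) (Fin n) ℝ) (hB : ∀ i j, B i j = B j i)
    (x c : EuclideanSpace ℝ (Fin n)) (t : ℝ) :
    QF B (x + t • c) = QF B x + 2 * t * (∑ i, c i * ∑ j, B i j * x j) + t ^ 2 * QF B c := by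
  have h : ∑ i, ∑ j, B i j * x i * c j = ∑ i, c i * ∑ j, B i j * x j := by
    rw [Finset.sum_comm]
    refine Finset.sum_congr rfl fun i _ => ?_
    rw [Finset.mul_sum]
    refine Finset.sum_congr rfl fun j _ => ?_
    rw [hB j i]; ring
  have h' : ∑ i, ∑ j, B i j * c i * x j = ∑ i, c i * ∑ j, B i j * x j := by
    refine Finset.sum_congr rfl fun i _ => ?_
    rw [Finset.mul_sum]
    refine Finset.sum_congr rfl fun j _ => ?_
    ring
  have e : QF B (x + t • c) = QF B x + t * (∑ i, ∑ j, B i j * x i * c j) +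
      t * (∑ i, ∑ j, B i j * c i * x j) + t ^ 2 * QF B c := by
    unfold QF
    simp only [Finset.mul_sum, ← Finset.sum_add_distrib]
    refine Finset.sum_congr rfl fun i _ => Finset.sum_congr rfl fun j _ => ?_
    simp only [PiLp.add_apply, PiLp.smul_apply, smul_eq_mul]
    ring
  rw [e, h, h']; ring

open scoped MatrixOrder Matrix.Norms.L2Operator in
lemma nomin {n : ℕ} (v : EuclideanSpace ℝ (Fin n) → ℝ) (hv : ContDiff ℝ 2 v)
    (A B : Matrix (Fin n) (Fin n) ℝ) (hA : A.PosSemidef) (hB : ∀ i j, B i j = B j i)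
    (x : EuclideanSpace ℝ (Fin n)) (hQ : 0 < QF B x) (p K : ℝ)
    (hm : IsLocalMin (fun y => v y + K * QF B y ^ p) x) :
    0 ≤ ∑ i, ∑ j, A i j * hess v x i j + K *
      (2 * p * (∑ i, ∑ j, A i j * B i j) * QF B x ^ (p - 1) + 4 * p * (p - 1) *
      (∑ i, ∑ j, A i j * (∑ k, B i k * x k) * (∑ k, B j k * x k)) * QF B x ^ (p - 2)) := by
  obtain ⟨M, rfl⟩ : ∃ M : Matrix (Fin n) (Fin n) ℝ, A = M.conjTranspose * M :=
    CStarAlgebra.nonneg_iff_eq_star_mul_self.mp hA.nonneg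
  have hij : ∀ i j, (M.conjTranspose * M) i j = ∑ k, M k i * M k j := by
    intro i j; simp [Matrix.mul_apply]
  have hk : ∀ k, 0 ≤ ∑ i, ∑ j, M k i * M k j * hess v x i j + K *
      (2 * p * (∑ i, ∑ j, M k i * M k j * B i j) * QF B x ^ (p - 1) + 4 * p * (p - 1) *
      (∑ i, ∑ j, M k i * M k j * (∑ k, B i k * x k) * (∑ k, B j k * x k)) * QF B x ^ (p - 2)) := by
    intro k
    let c : EuclideanSpace ℝ (Fin n) := WithLp.toLp 2 (M k)
    have hc : ∀ i, c i = M k i := fun i => rfl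
    have h1 := D2_line v hv x c
    have h2 := (D2_pow (QF B x) (∑ i, c i * ∑ j, B i j * x j) (QF B c) p hQ).const_mul K
    have h3 := h1.add h2
    simp only [← QF_line B hB] at h3
    have h4 : IsLocalMin (fun t : ℝ => v (x + t • c) + K * QF B (x + t • c) ^ p) 0 := by
      have hcont : Tendsto (fun t : ℝ => x + t • c) (𝓝 0) (𝓝 x) := by
        have : Continuous (fun t : ℝ => x + t • c) := by fun_prop
        simpa using this.tendsto 0
      have := hcont.eventually hm
      simpa [IsLocalMin, IsMinFilter] using this
    have h5 := h3.nonneg h4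
    have e1 : QF B c = ∑ i, ∑ j, M k i * M k j * B i j := by
      unfold QF
      refine Finset.sum_congr rfl fun i _ => Finset.sum_congr rfl fun j _ => ?_
      rw [hc, hc]; ring
    have e2 : (∑ i, c i * ∑ j, B i j * x j) ^ 2 =
        ∑ i, ∑ j, M k i * M k j * (∑ k, B i k * x k) * (∑ k, B j k * x k) := by
      rw [sq, Finset.sum_mul_sum]
      refine Finset.sum_congr rfl fun i _ => Finset.sum_congr rfl fun j _ => ?_
      rw [hc, hc]; ring
    rw [e1, e2] at h5
    exact h5
  have hsum := Finset.sum_nonneg fun k (_ : k ∈ Finset.univ) => hk k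
  refine hsum.trans_eq ?_
  have sw : ∀ G : Fin n → Fin n → ℝ, ∑ i, ∑ j, (M.conjTranspose * M) i j * G i j =
      ∑ k, ∑ i, ∑ j, M k i * M k j * G i j := by
    intro G
    simp only [hij, Finset.sum_mul]
    conv_rhs => rw [Finset.sum_comm]
    exact Finset.sum_congr rfl fun i _ => Finset.sum_comm
  have s1 := sw (fun i j => hess v x i j)
  have s2 := sw (fun i j => B i j)
  have s3 := sw (fun i j => (∑ k, B i k * x k) * (∑ k, B j k * x k))
  simp only [← mul_assoc] at s3
  rw [s1, s2, s3]
  rw [Finset.sum_add_distrib, ← Finset.mul_sum, Finset.sum_add_distrib, ← Finset.sum_mul,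
    ← Finset.sum_mul, ← Finset.mul_sum, ← Finset.mul_sum]

lemma QF_lower {n : ℕ} (hn : 3 ≤ n) (B : Matrix (Fin n) (Fin n) ℝ) (hB : B.PosDef) :
    ∃ m : ℝ, 0 < m ∧ ∀ x : EuclideanSpace ℝ (Fin n), m * ‖x‖ ^ 2 ≤ QF B x := by
  have : Nonempty (Fin n) := ⟨⟨0, by omega⟩⟩
  have : Nontrivial (EuclideanSpace ℝ (Fin n)) := inferInstance
  have hpos : ∀ x : EuclideanSpace ℝ (Fin n), x ≠ 0 → 0 < QF B x := by
    intro x hx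
    have h := hB.dotProduct_mulVec_pos (x := x.ofLp) (by simpa using hx)
    refine h.trans_eq ?_
    symm
    simp only [QF, dotProduct, Matrix.mulVec, Finset.mul_sum]
    refine Finset.sum_congr rfl fun i _ => Finset.sum_congr rfl fun j _ => ?_
    simp; ring
  obtain ⟨z, hz, hzm⟩ := (isCompact_sphere (0 : EuclideanSpace ℝ (Fin n)) 1).exists_isMinOn
    (NormedSpace.sphere_nonempty.2 zero_le_one) (QF_cont B).continuousOn
  have hz1 : ‖z‖ = 1 := by simpa using hz
  refine ⟨QF B z, hpos z (by rintro rfl; simp at hz1), fun x => ?_⟩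
  have hs : ∀ (t : ℝ) (y : EuclideanSpace ℝ (Fin n)), QF B (t • y) = t ^ 2 * QF B y := by
    intro t y
    unfold QF
    simp only [Finset.mul_sum]
    refine Finset.sum_congr rfl fun i _ => Finset.sum_congr rfl fun j _ => ?_
    simp; ring
  by_cases hx : x = 0
  · subst hx; simp [QF]
  have hxn : 0 < ‖x‖ := norm_pos_iff.2 hx
  have h1 : QF B z ≤ QF B (‖x‖⁻¹ • x) := hzm (by
    simp [norm_smul, hxn.ne'])
  rw [hs] at h1
  calc QF B z * ‖x‖ ^ 2 ≤ (‖x‖⁻¹ ^ 2 * QF B x) * ‖x‖ ^ 2 := by gcongr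
    _ = QF B x := by field_simp

lemma form_bound {n : ℕ} (E : Matrix (Fin n) (Fin n) ℝ) (η Y : ℝ) (hη : 0 ≤ η) (y : Fin n → ℝ)
    (hE : ∀ i j, |E i j| ≤ η) (hy : ∀ i, |y i| ≤ Y) :
    |∑ i, ∑ j, E i j * y i * y j| ≤ η * ((n:ℝ) ^ 2 * Y ^ 2) := by
  have : ∀ i j, |E i j * y i * y j| ≤ η * Y ^ 2 := by
    intro i j
    have hY : 0 ≤ Y := (abs_nonneg _).trans (hy i)
    rw [abs_mul, abs_mul, sq, ← mul_assoc]
    gcongr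
    exacts [hE i j, hy i, hy j]
  calc |∑ i, ∑ j, E i j * y i * y j| ≤ ∑ i : Fin n, ∑ j : Fin n, η * Y ^ 2 := by
        refine (Finset.abs_sum_le_sum_abs _ _).trans (Finset.sum_le_sum fun i _ => ?_)
        exact (Finset.abs_sum_le_sum_abs _ _).trans (Finset.sum_le_sum fun j _ => this i j)
    _ = _ := by simp; ring

lemma barrier {n : ℕ} (hn : 3 ≤ n) (a : EuclideanSpace ℝ (Fin n) → Matrix (Fin n) (Fin n) ℝ)
    (ainf : Matrix (Fin n) (Fin n) ℝ) (hainf : ainf.PosDef)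
    (ε₀ C₀ : ℝ) (hε : 0 < ε₀) (hC₀ : 0 < C₀)
    (hd : ∀ x : EuclideanSpace ℝ (Fin n), x ≠ 0 → ∀ i j : Fin n,
        |a x i j - ainf i j| ≤ C₀ * ‖x‖ ^ (-ε₀))
    (ζ : ℝ) (hζ : 2 < ζ) :
    ∃ (B : Matrix (Fin n) (Fin n) ℝ) (p c R m : ℝ), (∀ i j, B i j = B j i) ∧ p < 0 ∧ 0 < c ∧ 1 ≤ R ∧
      0 < m ∧ (∀ x, m * ‖x‖ ^ 2 ≤ QF B x) ∧
      ∀ x : EuclideanSpace ℝ (Fin n), R < ‖x‖ →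
        2 * p * (∑ i, ∑ j, a x i j * B i j) * QF B x ^ (p - 1) + 4 * p * (p - 1) *
      (∑ i, ∑ j, a x i j * (∑ k, B i k * x k) * (∑ k, B j k * x k)) * QF B x ^ (p - 2)
        ≤ - c * ‖x‖ ^ (-ζ) := by
  set B := ainf⁻¹ with hBdef
  have hB : B.PosDef := hainf.inv
  have hAB : ainf * B = 1 := Matrix.mul_nonsing_inv _ ((Matrix.isUnit_iff_isUnit_det _).1 hainf.isUnit)
  have hsym : ∀ i j, B i j = B j i := by
    intro i j
    have := hB.isHermitian.apply i j
    simpa using this.symm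
  obtain ⟨m, hm, hmQ⟩ := QF_lower hn B hB
  obtain ⟨β, hβ0, hβ⟩ : ∃ β : ℝ, 0 < β ∧ ∀ i j, |B i j| ≤ β := by
    refine ⟨∑ i, ∑ j, |B i j| + 1, by positivity, fun i j => ?_⟩
    have h1 : |B i j| ≤ ∑ j, |B i j| :=
      Finset.single_le_sum (f := fun j => |B i j|) (fun _ _ => abs_nonneg _) (Finset.mem_univ j)
    have h2 : ∑ j, |B i j| ≤ ∑ i, ∑ j, |B i j| :=
      Finset.single_le_sum (f := fun i => ∑ j, |B i j|)
        (fun _ _ => Finset.sum_nonneg fun _ _ => abs_nonneg _) (Finset.mem_univ i)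
    linarith
  have hxi : ∀ (x : EuclideanSpace ℝ (Fin n)) i, |x i| ≤ ‖x‖ := fun x i => by
    simpa using PiLp.norm_apply_le x i
  have hn0 : (3:ℝ) ≤ n := by exact_mod_cast hn
  set N : ℝ := (n:ℝ) ^ 2 with hN
  have hNpos : 0 < N := by positivity
  -- upper bound on Q
  set M := β * N with hM
  have hMpos : 0 < M := by positivity
  have hQM : ∀ x, QF B x ≤ M * ‖x‖ ^ 2 := by
    intro x
    have := form_bound B β ‖x‖ hβ0.le x hβ (hxi x)
    have := (le_abs_self _).trans this
    unfold QF
    linarith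
  have hy : ∀ (x : EuclideanSpace ℝ (Fin n)) i, |∑ k, B i k * x k| ≤ n * β * ‖x‖ := by
    intro x i
    calc |∑ k, B i k * x k| ≤ ∑ k : Fin n, β * ‖x‖ := by
          refine (Finset.abs_sum_le_sum_abs _ _).trans (Finset.sum_le_sum fun k _ => ?_)
          rw [abs_mul]
          exact mul_le_mul (hβ i k) (hxi x k) (abs_nonneg _) hβ0.le
      _ = _ := by simp; ring
  have hT0 : ∑ i, ∑ j, ainf i j * B i j = n := by
    have : (ainf * B).trace = n := by rw [hAB]; simp
    rw [← this]
    simp only [Matrix.trace, Matrix.diag, Matrix.mul_apply]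
    exact Finset.sum_congr rfl fun i _ => Finset.sum_congr rfl fun j _ => by rw [hsym i j]
  have hS0 : ∀ x, ∑ i, ∑ j, ainf i j * (∑ k, B i k * x k) * (∑ k, B j k * x k) = QF B x := by
    intro x
    have h1 : ∀ i, ∑ j, ainf i j * (∑ k, B j k * x k) = x i := by
      intro i
      have : (ainf.mulVec (B.mulVec x.ofLp)) i = x i := by
        rw [Matrix.mulVec_mulVec, hAB, Matrix.one_mulVec]
      rw [← this]; rfl
    unfold QF
    refine Finset.sum_congr rfl fun i _ => ?_
    have : ∑ j, ainf i j * (∑ k, B i k * x k) * (∑ k, B j k * x k) =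
        (∑ k, B i k * x k) * ∑ j, ainf i j * (∑ k, B j k * x k) := by
      rw [Finset.mul_sum]
      exact Finset.sum_congr rfl fun j _ => by ring
    rw [this, h1, Finset.sum_mul]
    exact Finset.sum_congr rfl fun j _ => by ring
  set κ := N * β + 3 * (N * (n * β) ^ 2 / m) with hκ
  have hκpos : 0 < κ := by positivity
  obtain ⟨R, hR1, hR⟩ : ∃ R : ℝ, 1 ≤ R ∧ ∀ r, R ≤ r → C₀ * r ^ (-ε₀) * κ ≤ 1 / 4 := by
    have ht : Tendsto (fun r : ℝ => C₀ * r ^ (-ε₀) * κ) atTop (𝓝 (C₀ * 0 * κ)) :=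
      ((tendsto_rpow_neg_atTop hε).const_mul C₀).mul_const κ
    have := ht.eventually (gt_mem_nhds (show C₀ * 0 * κ < 1/4 by simp))
    obtain ⟨R, hR⟩ := eventually_atTop.1 this
    exact ⟨max 1 R, le_max_left _ _, fun r hr => (hR r ((le_max_right _ _).trans hr)).le⟩
  obtain ⟨s, hs0, hs4, hsζ⟩ : ∃ s : ℝ, 0 < s ∧ s ≤ 1/4 ∧ 2 * s + 2 ≤ ζ := by
    refine ⟨min (1/4) ((ζ-2)/2), lt_min (by norm_num) (by linarith), min_le_left _ _, ?_⟩
    linarith [min_le_right (1/4) ((ζ-2)/2)]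
  refine ⟨B, -s, s / 2 * M ^ (-s - 1), R, m, hsym, by linarith, by positivity, hR1, hm, hmQ, ?_⟩
  intro x hx
  have hx1 : 1 < ‖x‖ := by linarith
  have hx0 : x ≠ 0 := by rintro rfl; simp at hx1; linarith
  have hxp : 0 < ‖x‖ := by linarith
  have hQ : 0 < QF B x := lt_of_lt_of_le (by positivity) (hmQ x)
  set η := C₀ * ‖x‖ ^ (-ε₀) with hη
  have hη0 : 0 ≤ η := by positivity
  have hηκ : η * κ ≤ 1/4 := hR _ hx.le
  set T := ∑ i, ∑ j, a x i j * B i j with hT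
  set S := ∑ i, ∑ j, a x i j * (∑ k, B i k * x k) * (∑ k, B j k * x k) with hS
  set q := QF B x with hq
  have hTn : n - η * (N * β) ≤ T := by
    have e : T - n = ∑ i, ∑ j, (a x i j - ainf i j) * B i j := by
      rw [← hT0, hT]; simp only [sub_mul, Finset.sum_sub_distrib]
    have : |T - n| ≤ ∑ i : Fin n, ∑ j : Fin n, η * β := by
      rw [e]
      refine (Finset.abs_sum_le_sum_abs _ _).trans (Finset.sum_le_sum fun i _ => ?_)
      refine (Finset.abs_sum_le_sum_abs _ _).trans (Finset.sum_le_sum fun j _ => ?_)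
      rw [abs_mul]
      exact mul_le_mul (hd x hx0 i j) (hβ i j) (abs_nonneg _) hη0
    have e2 : ∑ i : Fin n, ∑ j : Fin n, η * β = η * (N * β) := by simp [hN]; ring
    rw [e2] at this
    linarith [(abs_le.1 this).1]
  have hSQ : S ≤ q + η * (N * (n * β) ^ 2 / m) * q := by
    have e : S - q = ∑ i, ∑ j, (a x i j - ainf i j) * (∑ k, B i k * x k) * (∑ k, B j k * x k) := by
      rw [hq, ← hS0, hS]; simp only [sub_mul, Finset.sum_sub_distrib]
    have h1 := form_bound (a x - ainf) η (n * β * ‖x‖) hη0 (fun i => ∑ k, B i k * x k)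
      (fun i j => hd x hx0 i j) (hy x)
    simp only [Matrix.sub_apply] at h1
    rw [← e] at h1
    have h2 : η * (N * (n * β * ‖x‖) ^ 2) ≤ η * (N * (n * β) ^ 2 / m) * q := by
      have : η * (N * (n * β * ‖x‖) ^ 2) = η * (N * (n * β) ^ 2 / m) * (m * ‖x‖ ^ 2) := by
        field_simp
      rw [this]
      gcongr
      exact hmQ x
    linarith [(abs_le.1 h1).2]
  have hmain : q / 4 ≤ T * q - 2 * (s + 1) * S := by
    set g := η * (N * (n * β) ^ 2 / m) with hg
    have hg0 : 0 ≤ g := by positivity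
    have h1 : (n - η * (N * β)) * q ≤ T * q := by gcongr
    have h2 : 2 * (s + 1) * S ≤ 2 * (s + 1) * (q + g * q) := by gcongr
    have h3 : η * (N * β) + 3 * g ≤ 1/4 := by
      have : η * κ = η * (N * β) + 3 * g := by rw [hκ, hg]; ring
      linarith
    have h4 : 2 * (s + 1) * (q + g * q) ≤ (5/2) * (q + g * q) := by
      gcongr; linarith
    have h5 : 1/4 * q ≤ (n - η * (N * β) - 5/2 - 5/2 * g) * q := by
      gcongr; linarith
    nlinarith
  have hrp : q ^ (-s - 1) = q * q ^ (-s - 2) := by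
    rw [show -s - 1 = (-s - 2) + 1 by ring, Real.rpow_add_one hQ.ne']; ring
  have hpp : 0 < q ^ (-s - 2) := by positivity
  have step1 : 2 * -s * T * q ^ (-s - 1) + 4 * -s * (-s - 1) * S * q ^ (-s - 2) ≤
      - (s / 2) * q ^ (-s - 1) := by
    rw [hrp]
    have : 2 * -s * T * (q * q ^ (-s - 2)) + 4 * -s * (-s - 1) * S * q ^ (-s - 2) =
      - (2 * s * q ^ (-s - 2) * (T * q - 2 * (s + 1) * S)) := by ring
    rw [this]
    have : 2 * s * q ^ (-s - 2) * (q / 4) ≤ 2 * s * q ^ (-s - 2) * (T * q - 2 * (s + 1) * S) := by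
      gcongr
    linarith
  have step2 : M ^ (-s - 1) * ‖x‖ ^ (-ζ) ≤ q ^ (-s - 1) := by
    calc M ^ (-s - 1) * ‖x‖ ^ (-ζ) ≤ M ^ (-s - 1) * ‖x‖ ^ (2 * (-s - 1)) := by
          gcongr
          · exact hx1.le
          · linarith
      _ = (M * ‖x‖ ^ 2) ^ (-s - 1) := by
          rw [Real.mul_rpow hMpos.le (by positivity), Real.rpow_mul hxp.le]
          norm_num
      _ ≤ q ^ (-s - 1) := Real.rpow_le_rpow_of_nonpos hQ (hQM x) (by linarith)
  calc _ ≤ _ := step1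
    _ = - (s / 2 * q ^ (-s - 1)) := by ring
    _ ≤ - (s / 2 * (M ^ (-s - 1) * ‖x‖ ^ (-ζ))) := by gcongr
    _ = _ := by ring

/-- **Remark 3.4**: if `v ∈ C²(ℝⁿ)`, `n ≥ 3`, solves `a_{ij}(x)D_{ij}v = f` where the
coefficients are symmetric, uniformly elliptic, globally `C^α`, converge to a positive
definite matrix `a(∞)` at rate `|x|^{-ε₀}`, `f` is continuous with
`limsup_{|x|→∞}|x|^ζ|f| < ∞`, `ζ > 2`, and `|Dv(x)| = O(|x|^{-1})` as `|x| → ∞`, then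
`v` is bounded from at least one side. -/
theorem linear_elliptic_one_side_bounded
    (n : ℕ) (hn : 3 ≤ n) (α ζ : ℝ) (hα₀ : 0 < α) (hα₁ : α < 1) (hζ : 2 < ζ)
    (a : EuclideanSpace ℝ (Fin n) → Matrix (Fin n) (Fin n) ℝ)
    (ha_symm : ∀ x, (a x).IsSymm)
    (ha_ell : ∃ lam Lam : ℝ, 0 < lam ∧ lam ≤ Lam ∧
      ∀ (x ξ : EuclideanSpace ℝ (Fin n)),
        lam * ‖ξ‖ ^ 2 ≤ ∑ i, ∑ j, a x i j * ξ i * ξ j ∧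
        ∑ i, ∑ j, a x i j * ξ i * ξ j ≤ Lam * ‖ξ‖ ^ 2)
    (ha_holder : ∃ C : ℝ, ∀ (x y : EuclideanSpace ℝ (Fin n)) (i j : Fin n),
      |a x i j - a y i j| ≤ C * ‖x - y‖ ^ α)
    (ainf : Matrix (Fin n) (Fin n) ℝ) (hainf : ainf.PosDef)
    (ha_decay : ∃ ε₀ C₀ : ℝ, 0 < ε₀ ∧ 0 < C₀ ∧
      ∀ x : EuclideanSpace ℝ (Fin n), x ≠ 0 → ∀ i j : Fin n,
        |a x i j - ainf i j| ≤ C₀ * ‖x‖ ^ (-ε₀))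
    (f : EuclideanSpace ℝ (Fin n) → ℝ) (hf_cont : Continuous f)
    (hf_decay : ∃ C R : ℝ, 0 < C ∧ 0 < R ∧
      ∀ x : EuclideanSpace ℝ (Fin n), R ≤ ‖x‖ → ‖x‖ ^ ζ * |f x| ≤ C)
    (v : EuclideanSpace ℝ (Fin n) → ℝ) (hv : ContDiff ℝ 2 v)
    (heq : ∀ x, ∑ i, ∑ j, a x i j * hess v x i j = f x)
    (hDv : ∃ C R : ℝ, 0 < C ∧ 0 < R ∧ ∀ x : EuclideanSpace ℝ (Fin n), R ≤ ‖x‖ →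
      ‖fderiv ℝ v x‖ ≤ C * ‖x‖⁻¹) :
    BddAbove (Set.range v) ∨ BddBelow (Set.range v) := by
  obtain ⟨lam, Lam, hlam, -, hell⟩ := ha_ell
  obtain ⟨ε₀, C₀, hε, hC₀, hd⟩ := ha_decay
  obtain ⟨Cf, Rf, hCf, hRf, hf⟩ := hf_decay
  obtain ⟨Cv, Rv, hCv, hRv, hDv⟩ := hDv
  obtain ⟨B, p, c, R, m, hB, hp, hc, hR, hm, hmQ, hbar⟩ :=
    barrier hn a ainf hainf ε₀ C₀ hε hC₀ hd ζ hζ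
  set R' := max R (max Rf (2 * Rv)) with hR'
  have hRR : R ≤ R' := le_max_left _ _
  have hRf' : Rf ≤ R' := (le_max_left _ _).trans (le_max_right _ _)
  have hRv' : 2 * Rv ≤ R' := (le_max_right _ _).trans (le_max_right _ _)
  have hQpos : ∀ x : EuclideanSpace ℝ (Fin n), R' < ‖x‖ → m ≤ QF B x := by
    intro x hx
    have h1 : 1 ≤ ‖x‖ := by linarith
    have h2 : 1 ≤ ‖x‖ ^ 2 := one_le_pow₀ h1
    have := hmQ x
    nlinarith
  refine final v (fun x => QF B x ^ p) hv.continuous R' ((Cf + 1) / c) (m ^ p) (8 * Cv)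
    (by positivity) ?_ ?_ ?_ ?_ ?_
  · intro x hx
    exact (QF_cont B).continuousAt.rpow_const (Or.inl (hm.trans_le (hQpos x hx)).ne')
  · intro x hx
    exact Real.rpow_nonneg (hm.le.trans (hQpos x hx)) _
  · intro x hx
    exact Real.rpow_le_rpow_of_nonpos hm (hQpos x hx) hp.le
  · intro x y hx hxy
    exact osc hn v hv Cv Rv hCv hRv hDv x y (by linarith) hxy
  · intro x hx hmin
    have hA : (a x).PosSemidef := by
      refine Matrix.PosSemidef.of_dotProduct_mulVec_nonneg ?_ ?_
      · have := ha_symm x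
        rw [Matrix.IsHermitian, Matrix.conjTranspose_eq_transpose_of_trivial]
        exact this
      · intro ξ
        have h1 := (hell x (WithLp.toLp 2 ξ)).1
        have h2 : 0 ≤ lam * ‖(WithLp.toLp 2 ξ : EuclideanSpace ℝ (Fin n))‖ ^ 2 := by positivity
        refine (h2.trans h1).trans_eq ?_
        simp only [dotProduct, Matrix.mulVec, Finset.mul_sum]
        refine Finset.sum_congr rfl fun i _ => Finset.sum_congr rfl fun j _ => ?_
        simp; ring
    have h := nomin v hv (a x) B hA hB x (hm.trans_le (hQpos x hx)) p ((Cf + 1) / c) hmin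
    have hb := hbar x (by linarith)
    rw [heq] at h
    have hxp : 0 < ‖x‖ := by linarith
    have hfx : f x ≤ Cf * ‖x‖ ^ (-ζ) := by
      have h1 := hf x (by linarith)
      have h2 : 0 < ‖x‖ ^ ζ := by positivity
      rw [Real.rpow_neg hxp.le, ← div_eq_mul_inv, le_div_iff₀ h2]
      nlinarith [le_abs_self (f x)]
    have hK : 0 ≤ (Cf + 1) / c := by positivity
    have h3 := mul_le_mul_of_nonneg_left hb hK
    have h4 : (Cf + 1) / c * (-c * ‖x‖ ^ (-ζ)) = -(Cf + 1) * ‖x‖ ^ (-ζ) := by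
      field_simp
    have h5 : 0 < ‖x‖ ^ (-ζ) := by positivity
    rw [h4] at h3
    linarith
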